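/- arXiv:2410.09568 — 7 statements merged into one kernel-verified Lean document; each statement's English description precedes it below -/
import Mathlib

section
/- Let a : ℕ → ℝ satisfy a_s ≥ 0 for all s, a_0 > 0, and the recursion a_{s+1} ≤ a_s^{3/2}/(2·√(a_0)) for all s ≥ 0. Then a_s ≤ (1/2)^{2·(3/2)^s − 2} · a_0 for every s ≥ 0; in particular, a_s ≤ (1/2)^{(3/2)^s} · a_0 for every s ≥ 2 and a_1 ≤ a_0/2. -/
/-- One step of the recursion: the exponent `e` of `1/2` becomes `3e/2 + 1`. -/
lemma half_rpow_mul_rpow_div {A : ℝ} (hA : 0 < A) (e : ℝ) :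
    (((1 : ℝ) / 2) ^ e * A) ^ ((3 : ℝ) / 2) / (2 * Real.sqrt A) =
      ((1 : ℝ) / 2) ^ (e * (3 / 2) + 1) * A := by
  have hs : 0 < Real.sqrt A := Real.sqrt_pos.mpr hA
  have hA32 : A ^ ((3 : ℝ) / 2) = A * Real.sqrt A := by
    rw [Real.sqrt_eq_rpow, ← Real.rpow_one_add' hA.le (by norm_num)]
    norm_num
  rw [Real.mul_rpow (by positivity) hA.le, ← Real.rpow_mul (by norm_num), hA32,
    Real.rpow_add (by norm_num), Real.rpow_one]
  field_simp

/-- Superlinear convergence of the restart recursion: if `a_s ≥ 0`, `a_0 > 0` and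
`a_{s+1} ≤ a_s^{3/2}/(2√(a_0))`, then `a_s ≤ (1/2)^{2·(3/2)^s − 2} a_0` for all `s`;
in particular `a_s ≤ (1/2)^{(3/2)^s} a_0` for `s ≥ 2` and `a_1 ≤ a_0/2`. -/
theorem restart_superlinear (a : ℕ → ℝ) (ha : ∀ s, 0 ≤ a s) (ha0 : 0 < a 0)
    (hrec : ∀ s, a (s + 1) ≤ a s ^ ((3 : ℝ) / 2) / (2 * Real.sqrt (a 0))) :
    (∀ s : ℕ, a s ≤ ((1 : ℝ) / 2) ^ (2 * ((3 : ℝ) / 2) ^ s - 2) * a 0) ∧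
      (∀ s : ℕ, 2 ≤ s → a s ≤ ((1 : ℝ) / 2) ^ (((3 : ℝ) / 2) ^ s) * a 0) ∧
      a 1 ≤ a 0 / 2 := by
  have key : ∀ s : ℕ, a s ≤ ((1 : ℝ) / 2) ^ (2 * ((3 : ℝ) / 2) ^ s - 2) * a 0 := by
    intro s
    induction s with
    | zero => norm_num
    | succ s ih =>
      calc a (s + 1) ≤ a s ^ ((3 : ℝ) / 2) / (2 * Real.sqrt (a 0)) := hrec s
        _ ≤ (((1 : ℝ) / 2) ^ (2 * ((3 : ℝ) / 2) ^ s - 2) * a 0) ^ ((3 : ℝ) / 2) /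
              (2 * Real.sqrt (a 0)) := by
            have := Real.rpow_le_rpow (ha s) ih (by norm_num : (0 : ℝ) ≤ 3 / 2)
            gcongr
        _ = ((1 : ℝ) / 2) ^ (2 * ((3 : ℝ) / 2) ^ (s + 1) - 2) * a 0 := by
            rw [half_rpow_mul_rpow_div ha0]
            congr 2
            ring
  refine ⟨key, fun s hs => (key s).trans ?_, ?_⟩
  · have hpow : ((3 : ℝ) / 2) ^ 2 ≤ ((3 : ℝ) / 2) ^ s :=
      pow_le_pow_right₀ (by norm_num) hs
    refine mul_le_mul_of_nonneg_right ?_ ha0.le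
    exact Real.rpow_le_rpow_of_exponent_ge (by norm_num) (by norm_num) (by linarith)
  · have h := key 1
    norm_num at h
    linarith
end

section
/- Let F : E → E be differentiable and monotone with ρ-Lipschitz derivative, and let M > 0. Suppose w, z, z½, z⁺ ∈ E satisfy z½ ≠ z, the implicit lazy cubic step F(z) + ∇F(w)(z½ − z) + M‖z½ − z‖·(z½ − z) = 0, and the extragradient step z⁺ = z − γ^{−1}·F(z½), where γ := M‖z½ − z‖. Then for every u ∈ E: γ^{−1}·⟨F(z½), z½ − u⟩ ≤ (1/2)‖z − u‖² − (1/2)‖z⁺ − u‖² − (1/2)‖z½ − z⁺‖² − (1/2)‖z − z½‖² + (ρ²/(2M²))·‖z − z½‖² + (2ρ²/M²)·‖w − z‖². -/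
open RealInnerProductSpace

/-- If the derivative of `F` is `ρ`-Lipschitz, then the linearization of `F` along the segment
from `x` to `x + d` with derivative frozen at `w` has error at most
`ρ / 2 * ‖d‖ ^ 2 + ρ * ‖w - x‖ * ‖d‖`. -/
theorem norm_sub_sub_fderiv_le_of_lipschitz_fderiv {E G : Type*} [NormedAddCommGroup E]
    [NormedSpace ℝ E] [NormedAddCommGroup G] [NormedSpace ℝ G] {F : E → G} {ρ : ℝ}
    (hρ : 0 ≤ ρ) (hF : Differentiable ℝ F)
    (hlip : ∀ x y : E, ‖fderiv ℝ F x - fderiv ℝ F y‖ ≤ ρ * ‖x - y‖) (w x d : E) :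
    ‖F (x + d) - F x - fderiv ℝ F w d‖ ≤ ρ / 2 * ‖d‖ ^ 2 + ρ * ‖w - x‖ * ‖d‖ := by
  have hderiv : ∀ t : ℝ, HasDerivAt (fun t : ℝ => F (x + t • d) - F x - t • fderiv ℝ F w d)
      ((fderiv ℝ F (x + t • d) - fderiv ℝ F w) d) t := by
    intro t
    have hline : HasDerivAt (fun t : ℝ => x + t • d) d t := by
      simpa using ((hasDerivAt_id t).smul_const d).const_add x
    have hlin : HasDerivAt (fun t : ℝ => t • fderiv ℝ F w d) (fderiv ℝ F w d) t := by
      simpa using (hasDerivAt_id t).smul_const (fderiv ℝ F w d)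
    exact (((hF _).hasFDerivAt.comp_hasDerivAt t hline).sub_const (F x)).sub hlin
  have hbound : ∀ t : ℝ, HasDerivAt
      (fun t : ℝ => ρ / 2 * ‖d‖ ^ 2 * t ^ 2 + ρ * ‖w - x‖ * ‖d‖ * t)
      (ρ * (t * ‖d‖ + ‖w - x‖) * ‖d‖) t := by
    intro t
    refine (((hasDerivAt_pow 2 t).const_mul (ρ / 2 * ‖d‖ ^ 2)).add
      ((hasDerivAt_id' t).const_mul (ρ * ‖w - x‖ * ‖d‖))).congr_deriv ?_
    push_cast
    ring
  have key := image_norm_le_of_norm_deriv_right_le_deriv_boundary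
    (a := (0 : ℝ)) (b := 1)
    (fun t _ => (hderiv t).continuousAt.continuousWithinAt)
    (fun t _ => (hderiv t).hasDerivWithinAt) (by simp) hbound
    (fun t ht => ?_) (Set.right_mem_Icc.2 zero_le_one)
  · simpa using key
  · refine (ContinuousLinearMap.le_opNorm _ d).trans ?_
    gcongr
    refine (hlip _ _).trans ?_
    gcongr
    calc ‖x + t • d - w‖ = ‖t • d - (w - x)‖ := by congr 1; abel
      _ ≤ ‖t • d‖ + ‖w - x‖ := norm_sub_le _ _
      _ = t * ‖d‖ + ‖w - x‖ := by rw [norm_smul, Real.norm_of_nonneg ht.1]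

/-- Lemma 3 (one-step descent inequality of LEN with a lazy Hessian): for a
differentiable monotone `F` with `ρ`-Lipschitz derivative, if `z½` solves the
implicit lazy cubic step at snapshot `w` and `z⁺` is the extragradient step, then
for every `u`,
`γ⁻¹⟨F(z½), z½ − u⟩ ≤ ½‖z−u‖² − ½‖z⁺−u‖² − ½‖z½−z⁺‖² − ½‖z−z½‖²
  + (ρ²/(2M²))‖z−z½‖² + (2ρ²/M²)‖w−z‖²`, where `γ = M‖z½ − z‖`. -/
theorem len_one_step_inequality {E : Type*} [NormedAddCommGroup E]
    [InnerProductSpace ℝ E] [FiniteDimensional ℝ E]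
    (F : E → E) (ρ M : ℝ) (hM : 0 < M)
    (hF : Differentiable ℝ F)
    (hmono : ∀ z z' : E, 0 ≤ ⟪F z - F z', z - z'⟫)
    (hlip : ∀ z z' : E, ‖fderiv ℝ F z - fderiv ℝ F z'‖ ≤ ρ * ‖z - z'‖)
    (w z zh zp : E) (hne : zh ≠ z)
    (hstep : F z + (fderiv ℝ F w) (zh - z) + (M * ‖zh - z‖) • (zh - z) = 0)
    (hextra : zp = z - (M * ‖zh - z‖)⁻¹ • F zh) :
    ∀ u : E,
      (M * ‖zh - z‖)⁻¹ * ⟪F zh, zh - u⟫ ≤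
        1 / 2 * ‖z - u‖ ^ 2 - 1 / 2 * ‖zp - u‖ ^ 2 - 1 / 2 * ‖zh - zp‖ ^ 2 -
          1 / 2 * ‖z - zh‖ ^ 2 + ρ ^ 2 / (2 * M ^ 2) * ‖z - zh‖ ^ 2 +
          2 * ρ ^ 2 / M ^ 2 * ‖w - z‖ ^ 2 := by
  intro u
  have hd : 0 < ‖zh - z‖ := norm_pos_iff.2 (sub_ne_zero.2 hne)
  have hρ : 0 ≤ ρ :=
    nonneg_of_mul_nonneg_left ((norm_nonneg _).trans (hlip zh z)) hd
  have htaylor := norm_sub_sub_fderiv_le_of_lipschitz_fderiv hρ hF hlip w z (zh - z)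
  rw [add_sub_cancel] at htaylor
  have hγ : 0 < M * ‖zh - z‖ := mul_pos hM hd
  have hresid : (M * ‖zh - z‖) • (zh - zp) = F zh - F z - fderiv ℝ F w (zh - z) := by
    have hsplit : zh - zp = (zh - z) + (M * ‖zh - z‖)⁻¹ • F zh := by rw [hextra]; abel
    rw [hsplit, smul_add, smul_inv_smul₀ hγ.ne', ← sub_eq_zero, ← hstep]
    abel
  have hnorm : ‖zh - zp‖ ≤ ρ / M * (‖zh - z‖ / 2 + ‖w - z‖) := by
    rw [← hresid, norm_smul, Real.norm_of_nonneg hγ.le] at htaylor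
    refine le_of_mul_le_mul_left (htaylor.trans_eq ?_) hγ
    field_simp
  have hsq : ‖zh - zp‖ ^ 2 ≤
      ρ ^ 2 / (2 * M ^ 2) * ‖z - zh‖ ^ 2 + 2 * ρ ^ 2 / M ^ 2 * ‖w - z‖ ^ 2 := by
    calc ‖zh - zp‖ ^ 2 ≤ (ρ / M * (‖zh - z‖ / 2 + ‖w - z‖)) ^ 2 := by gcongr
      _ = (ρ / M) ^ 2 * (‖zh - z‖ / 2 + ‖w - z‖) ^ 2 := mul_pow _ _ _
      _ ≤ (ρ / M) ^ 2 * (2 * ((‖zh - z‖ / 2) ^ 2 + ‖w - z‖ ^ 2)) := by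
        gcongr
        exact add_sq_le
      _ = _ := by
        rw [norm_sub_rev z zh]
        field_simp
  have hinner : (M * ‖zh - z‖)⁻¹ * ⟪F zh, zh - u⟫ = ⟪z - zp, zh - u⟫ := by
    rw [← real_inner_smul_left, hextra, sub_sub_cancel]
  have hident : ⟪z - zp, zh - u⟫ = 1 / 2 * ‖z - u‖ ^ 2 - 1 / 2 * ‖zp - u‖ ^ 2 +
      1 / 2 * ‖zh - zp‖ ^ 2 - 1 / 2 * ‖z - zh‖ ^ 2 := by
    simp only [norm_sub_sq_real, inner_sub_left, inner_sub_right]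
    rw [real_inner_comm zh zp]
    ring
  rw [hinner, hident]
  linarith
end

section
/- Let F : E → E be differentiable and monotone with ρ-Lipschitz derivative. Let m ≥ 1, let M > 0 with M ≥ 3ρm, let T ≥ 1, and let (z_t)_{t ≤ T}, (h_t)_{t < T} be a LEN trajectory for F with snapshot period m started at z_0. Then for every u ∈ E: ∑_{t=0}^{T−1} γ_t^{−1}·⟨F(h_t), h_t − u⟩ ≤ (1/2)‖z_0 − u‖² − (1/2)‖z_T − u‖² − (1/8)·∑_{t=0}^{T−1} ‖z_t − h_t‖². -/
open RealInnerProductSpace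

/-- First-order expansion error when the derivative at `z` is replaced by the one at `w`. -/
lemma norm_sub_sub_fderiv_le_of_lipschitz {E : Type*} [NormedAddCommGroup E]
    [NormedSpace ℝ E] {F : E → E} {ρ : ℝ} (hF : Differentiable ℝ F) (hρ : 0 ≤ ρ)
    (hlip : ∀ z z' : E, ‖fderiv ℝ F z - fderiv ℝ F z'‖ ≤ ρ * ‖z - z'‖) (w z h : E) :
    ‖F h - F z - fderiv ℝ F w (h - z)‖ ≤
      ρ * ‖h - z‖ * (‖z - w‖ + ‖h - z‖ / 2) := by
  set d := h - z with hd
  have hf : ∀ s : ℝ, HasDerivAt (fun s : ℝ => F (z + s • d) - F z - s • fderiv ℝ F w d)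
      (fderiv ℝ F (z + s • d) d - fderiv ℝ F w d) s := by
    intro s
    have h1 : HasDerivAt (fun s : ℝ => z + s • d) d s := by
      simpa using ((hasDerivAt_id s).smul_const d).const_add z
    have h2 := (hF (z + s • d)).hasFDerivAt.comp_hasDerivAt s h1
    have h3 : HasDerivAt (fun s : ℝ => s • fderiv ℝ F w d) (fderiv ℝ F w d) s := by
      simpa using (hasDerivAt_id s).smul_const (fderiv ℝ F w d)
    exact (h2.sub_const (F z)).sub h3
  have hB : ∀ s : ℝ, HasDerivAt (fun s : ℝ => ρ * ‖d‖ * (‖z - w‖ * s + ‖d‖ * s ^ 2 / 2))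
      (ρ * ‖d‖ * (‖z - w‖ + ‖d‖ * s)) s := by
    intro s
    have h1 := (((hasDerivAt_id s).const_mul ‖z - w‖).add
      ((((hasDerivAt_id s).pow 2).const_mul ‖d‖).div_const 2)).const_mul (ρ * ‖d‖)
    refine h1.congr_deriv ?_
    simp only [id_eq, Nat.cast_ofNat, Nat.add_one_sub_one, pow_one]
    ring
  have key := image_norm_le_of_norm_deriv_right_le_deriv_boundary
    (a := (0 : ℝ)) (b := 1)
    (fun s _ => (hf s).continuousAt.continuousWithinAt)
    (fun s _ => (hf s).hasDerivWithinAt) (by simp) hB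
    (fun s hs => by
      rw [← sub_apply]
      refine (ContinuousLinearMap.le_opNorm _ _).trans ?_
      have h1 := hlip (z + s • d) w
      have h2 : ‖z + s • d - w‖ ≤ ‖z - w‖ + ‖d‖ * s := by
        calc ‖z + s • d - w‖ = ‖(z - w) + s • d‖ := by congr 1; abel
          _ ≤ ‖z - w‖ + ‖s • d‖ := norm_add_le _ _
          _ = ‖z - w‖ + ‖d‖ * s := by
            rw [norm_smul, Real.norm_of_nonneg hs.1, mul_comm]
      calc _ ≤ ρ * (‖z - w‖ + ‖d‖ * s) * ‖d‖ := by gcongr; exact h1.trans (by gcongr)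
        _ = _ := by ring)
    (Set.right_mem_Icc.2 zero_le_one)
  simpa [hd] using key

/-- Summing over windows of length `m` counts every index at most `m` times. -/
lemma sum_sum_Ico_block_le {m : ℕ} (hm : 1 ≤ m) (T : ℕ) {b : ℕ → ℝ} (hb : ∀ s, 0 ≤ b s) :
    ∑ t ∈ Finset.range T, ∑ s ∈ Finset.Ico (m * (t / m)) t, b s ≤
      m * ∑ s ∈ Finset.range T, b s := by
  have hcount : ∀ t ∈ Finset.range T, ∑ s ∈ Finset.Ico (m * (t / m)) t, b s ≤
      ∑ s ∈ Finset.range T, if t ∈ Finset.Ico s (s + m) then b s else 0 := by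
    intro t ht
    rw [← Finset.sum_filter]
    refine Finset.sum_le_sum_of_subset_of_nonneg ?_ (fun s _ _ => hb s)
    intro s hs
    have h1 := Nat.div_add_mod t m
    have h2 := Nat.mod_lt t hm
    simp only [Finset.mem_Ico, Finset.mem_filter, Finset.mem_range] at *
    omega
  refine (Finset.sum_le_sum hcount).trans ?_
  rw [Finset.sum_comm, Finset.mul_sum]
  refine Finset.sum_le_sum fun s _ => ?_
  rw [← Finset.sum_filter, Finset.sum_const, nsmul_eq_mul]
  refine mul_le_mul_of_nonneg_right ?_ (hb s)
  have hsub : {t ∈ Finset.range T | t ∈ Finset.Ico s (s + m)} ⊆ Finset.Ico s (s + m) :=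
    fun t ht => (Finset.mem_filter.1 ht).2
  exact_mod_cast (Finset.card_le_card hsub).trans (by simp)

/-- Errors controlled by averages of past steps and errors within a block are square-summably
dominated by the steps. -/
lemma sum_sq_le_of_block_recursion {m : ℕ} (hm : 1 ≤ m) (T : ℕ) {r e : ℕ → ℝ}
    (he : ∀ t, 0 ≤ e t)
    (hrec : ∀ t < T, 3 * m * e t ≤ r t / 2 + ∑ s ∈ Finset.Ico (m * (t / m)) t, (r s + e s)) :
    ∑ t ∈ Finset.range T, e t ^ 2 ≤ 3 / 4 * ∑ t ∈ Finset.range T, r t ^ 2 := by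
  have hm' : (1 : ℝ) ≤ m := by exact_mod_cast hm
  have hpt : ∀ t ∈ Finset.range T, 9 * (m : ℝ) ^ 2 * e t ^ 2 ≤ 3 / 4 * r t ^ 2 +
      3 * m * ∑ s ∈ Finset.Ico (m * (t / m)) t, (r s ^ 2 + e s ^ 2) := by
    intro t ht
    have h1 := hrec t (Finset.mem_range.1 ht)
    set S := ∑ s ∈ Finset.Ico (m * (t / m)) t, (r s + e s)
    have hcard : ((Finset.Ico (m * (t / m)) t).card : ℝ) ≤ m := by
      have h1 := Nat.div_add_mod t m
      have h2 := Nat.mod_lt t hm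
      rw [Nat.card_Ico]
      exact_mod_cast (by omega : t - m * (t / m) ≤ m)
    have hS : S ^ 2 ≤ m * (2 * ∑ s ∈ Finset.Ico (m * (t / m)) t, (r s ^ 2 + e s ^ 2)) := by
      refine (sq_sum_le_card_mul_sum_sq (s := Finset.Ico (m * (t / m)) t)
        (f := fun s => r s + e s)).trans ?_
      refine mul_le_mul hcard ?_ (Finset.sum_nonneg fun s _ => sq_nonneg _) (by positivity)
      rw [Finset.mul_sum]
      exact Finset.sum_le_sum fun s _ => by nlinarith [sq_nonneg (r s - e s)]
    have h0 : 0 ≤ 3 * (m : ℝ) * e t := mul_nonneg (by positivity) (he t)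
    have h2 := pow_le_pow_left₀ h0 h1 2
    nlinarith [sq_nonneg (r t - S)]
  have hsum := Finset.sum_le_sum hpt
  rw [← Finset.mul_sum, Finset.sum_add_distrib, ← Finset.mul_sum, ← Finset.mul_sum] at hsum
  have hblock := sum_sum_Ico_block_le hm T (b := fun s => r s ^ 2 + e s ^ 2)
    (fun s => by positivity)
  rw [Finset.sum_add_distrib (s := Finset.range T) (f := fun s => r s ^ 2)] at hblock
  have hR : 0 ≤ ∑ t ∈ Finset.range T, r t ^ 2 := Finset.sum_nonneg fun _ _ => sq_nonneg _
  set R := ∑ t ∈ Finset.range T, r t ^ 2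
  set Q := ∑ t ∈ Finset.range T, e t ^ 2
  have h1 : 3 * (m : ℝ) * _ ≤ 3 * (m : ℝ) * _ := mul_le_mul_of_nonneg_left hblock (by positivity)
  have h2 : R ≤ (m : ℝ) ^ 2 * R := le_mul_of_one_le_left hR (one_le_pow₀ hm')
  have h3 : (m : ℝ) ^ 2 * Q ≤ (m : ℝ) ^ 2 * (3 / 4 * R) := by nlinarith
  exact le_of_mul_le_mul_left h3 (by positivity)

/-- Key telescoped inequality for LEN trajectories: for a differentiable monotone `F`
with `ρ`-Lipschitz derivative, a snapshot period `m ≥ 1`, a regularization parameter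
`M ≥ 3ρm`, and a LEN trajectory `(z_t)_{t ≤ T}`, `(h_t)_{t < T}` (with
`γ_t = M‖h_t − z_t‖` and snapshot index `π(t) = m⌊t/m⌋`), one has, for every `u`,
`∑_{t<T} γ_t⁻¹⟨F(h_t), h_t − u⟩ ≤ ½‖z_0 − u‖² − ½‖z_T − u‖² − (1/8)∑_{t<T}‖z_t − h_t‖²`. -/
theorem len_telescoped_inequality {E : Type*} [NormedAddCommGroup E]
    [InnerProductSpace ℝ E] [FiniteDimensional ℝ E]
    (F : E → E) (ρ M : ℝ) (m T : ℕ) (hm : 1 ≤ m) (hM : 0 < M)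
    (hMρ : 3 * ρ * (m : ℝ) ≤ M) (hT : 1 ≤ T)
    (hF : Differentiable ℝ F)
    (hmono : ∀ z z' : E, 0 ≤ ⟪F z - F z', z - z'⟫)
    (hlip : ∀ z z' : E, ‖fderiv ℝ F z - fderiv ℝ F z'‖ ≤ ρ * ‖z - z'‖)
    (z h : ℕ → E)
    (hne : ∀ t < T, h t ≠ z t)
    (hstep : ∀ t < T,
      F (z t) + (fderiv ℝ F (z (m * (t / m)))) (h t - z t) +
        (M * ‖h t - z t‖) • (h t - z t) = 0)
    (hupd : ∀ t < T, z (t + 1) = z t - (M * ‖h t - z t‖)⁻¹ • F (h t)) :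
    ∀ u : E,
      ∑ t ∈ Finset.range T, (M * ‖h t - z t‖)⁻¹ * ⟪F (h t), h t - u⟫ ≤
        1 / 2 * ‖z 0 - u‖ ^ 2 - 1 / 2 * ‖z T - u‖ ^ 2 -
          1 / 8 * ∑ t ∈ Finset.range T, ‖z t - h t‖ ^ 2 := by
  intro u
  have hρ : 0 ≤ ρ := by
    have h1 := (norm_nonneg _).trans (hlip (h 0) (z 0))
    exact nonneg_of_mul_nonneg_left h1 (norm_pos_iff.2 (sub_ne_zero.2 (hne 0 hT)))
  have hrec : ∀ t < T, 3 * m * ‖h t - z (t + 1)‖ ≤ ‖h t - z t‖ / 2 +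
      ∑ s ∈ Finset.Ico (m * (t / m)) t, (‖h s - z s‖ + ‖h s - z (s + 1)‖) := by
    intro t ht
    have hr : 0 < ‖h t - z t‖ := norm_pos_iff.2 (sub_ne_zero.2 (hne t ht))
    have hγ : 0 < M * ‖h t - z t‖ := mul_pos hM hr
    have hdist : ‖z t - z (m * (t / m))‖ ≤
        ∑ s ∈ Finset.Ico (m * (t / m)) t, (‖h s - z s‖ + ‖h s - z (s + 1)‖) := by
      rw [← dist_eq_norm, dist_comm]
      refine dist_le_Ico_sum_of_dist_le (Nat.mul_div_le t m) fun {k} _ _ => ?_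
      refine (dist_triangle_left _ _ (h k)).trans (le_of_eq ?_)
      rw [dist_eq_norm, dist_eq_norm]
    have herr : (M * ‖h t - z t‖) • (h t - z (t + 1)) =
        F (h t) - F (z t) - fderiv ℝ F (z (m * (t / m))) (h t - z t) := by
      have h1 : h t - z (t + 1) = (h t - z t) + (M * ‖h t - z t‖)⁻¹ • F (h t) := by
        rw [hupd t ht]; abel
      rw [h1, smul_add, smul_inv_smul₀ hγ.ne', eq_neg_of_add_eq_zero_right (hstep t ht)]
      abel
    have hnorm := norm_sub_sub_fderiv_le_of_lipschitz hF hρ hlip (z (m * (t / m))) (z t) (h t)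
    rw [← herr, norm_smul, Real.norm_of_nonneg hγ.le] at hnorm
    have h1 : M * ‖h t - z (t + 1)‖ ≤
        ρ * (‖z t - z (m * (t / m))‖ + ‖h t - z t‖ / 2) := by
      refine le_of_mul_le_mul_right ?_ hr
      linarith
    set D := ‖z t - z (m * (t / m))‖
    have hD : 0 ≤ D := norm_nonneg _
    refine le_trans ?_ (by linarith : ‖h t - z t‖ / 2 + D ≤ _)
    have h2 : 3 * (m : ℝ) * (M * ‖h t - z (t + 1)‖) ≤
        3 * (m : ℝ) * (ρ * (D + ‖h t - z t‖ / 2)) :=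
      mul_le_mul_of_nonneg_left h1 (by positivity)
    have h3 : 3 * ρ * m * (D + ‖h t - z t‖ / 2) ≤ M * (D + ‖h t - z t‖ / 2) :=
      mul_le_mul_of_nonneg_right hMρ (by positivity)
    refine le_of_mul_le_mul_left ?_ hM
    linarith
  have hsq := sum_sq_le_of_block_recursion hm T (r := fun t => ‖h t - z t‖)
    (e := fun t => ‖h t - z (t + 1)‖) (fun _ => norm_nonneg _) hrec
  have hid : ∀ t ∈ Finset.range T, (M * ‖h t - z t‖)⁻¹ * ⟪F (h t), h t - u⟫ =
      1 / 2 * (‖z t - u‖ ^ 2 - ‖z (t + 1) - u‖ ^ 2) +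
        1 / 2 * ‖h t - z (t + 1)‖ ^ 2 - 1 / 2 * ‖h t - z t‖ ^ 2 := by
    intro t ht
    have h1 : (M * ‖h t - z t‖)⁻¹ • F (h t) = z t - z (t + 1) := by
      rw [hupd t (Finset.mem_range.1 ht)]; abel
    rw [← real_inner_smul_left, h1]
    have h2 := norm_sub_sq_real (h t - u) (z (t + 1) - u)
    have h3 := norm_sub_sq_real (h t - u) (z t - u)
    rw [sub_sub_sub_cancel_right] at h2 h3
    rw [h2, h3, ← sub_sub_sub_cancel_right (z t) (z (t + 1)) u, inner_sub_left,
      real_inner_comm (h t - u) (z t - u), real_inner_comm (h t - u) (z (t + 1) - u)]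
    ring
  rw [Finset.sum_congr rfl hid, Finset.sum_sub_distrib, Finset.sum_add_distrib,
    ← Finset.mul_sum, ← Finset.mul_sum, ← Finset.mul_sum,
    Finset.sum_range_sub' (fun t => ‖z t - u‖ ^ 2)]
  simp only [norm_sub_rev (z _) (h _)]
  linarith
end

section
/- Let F : E → E be differentiable and monotone with ρ-Lipschitz derivative, and suppose z* ∈ E satisfies F(z*) = 0. Let m ≥ 1, let M > 0 with M ≥ 3ρm, let T ≥ 1, and let (z_t)_{t ≤ T}, (h_t)_{t < T} be a LEN trajectory for F with snapshot period m started at z_0. Then ‖z_t − z*‖ ≤ ‖z_0 − z*‖ for all 0 ≤ t ≤ T, and ‖z_t − h_t‖ ≤ 2‖z_0 − z*‖ and ‖h_t − z*‖ ≤ 3‖z_0 − z*‖ for all 0 ≤ t < T. -/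
open RealInnerProductSpace

/-- Mean value estimate for the error of the affine model of `F` at `x` built with the derivative
taken at another point `w`, when the derivative is `ρ`-Lipschitz. -/
theorem norm_sub_sub_fderiv_apply_le {E : Type*} [NormedAddCommGroup E] [NormedSpace ℝ E]
    {F : E → E} {ρ : ℝ} (hρ : 0 ≤ ρ) (hF : Differentiable ℝ F)
    (hlip : ∀ x y : E, ‖fderiv ℝ F x - fderiv ℝ F y‖ ≤ ρ * ‖x - y‖) (w x y : E) :
    ‖F y - F x - fderiv ℝ F w (y - x)‖ ≤ ρ * (‖y - x‖ + ‖x - w‖) * ‖y - x‖ := by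
  refine (convex_segment x y).norm_image_sub_le_of_norm_fderiv_le'
    (fun u _ => hF u) (fun u hu => ?_) (left_mem_segment ℝ x y) (right_mem_segment ℝ x y)
  refine (hlip u w).trans (mul_le_mul_of_nonneg_left ?_ hρ)
  have hux : ‖u - x‖ ≤ ‖y - x‖ := by
    obtain ⟨θ, ⟨h0, h1⟩, rfl⟩ := segment_eq_image' ℝ x y ▸ hu
    rw [add_sub_cancel_left, norm_smul, Real.norm_of_nonneg h0]
    exact mul_le_of_le_one_left (norm_nonneg _) h1
  linarith [norm_sub_le_norm_sub_add_norm_sub u x w]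

/-- One extragradient step with a monotone operator vanishing at `p`. -/
theorem extragradient_step {E : Type*} [NormedAddCommGroup E] [InnerProductSpace ℝ E]
    {x y v p : E} {γ : ℝ} (hγ : 0 ≤ γ) (hv : 0 ≤ ⟪v, y - p⟫) :
    ‖x - γ • v - p‖ ^ 2 + ‖y - x‖ ^ 2 ≤ ‖x - p‖ ^ 2 + ‖x - γ • v - y‖ ^ 2 := by
  have h1 : x - γ • v - p = (x - p) - γ • v := by abel
  have h2 : x - γ • v - y = (x - y) - γ • v := by abel
  have h3 : ⟪v, y - p⟫ = ⟪x - p, v⟫ - ⟪x - y, v⟫ := by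
    rw [← inner_sub_left, sub_sub_sub_cancel_left, real_inner_comm]
  rw [h1, h2, norm_sub_sq_real, norm_sub_sq_real (x - y), norm_sub_rev y x,
    real_inner_smul_right, real_inner_smul_right]
  nlinarith [mul_nonneg hγ hv]

/-- The distance between the half-iterate and the next iterate of a lazy extra-Newton step. -/
theorem norm_len_step_sub_le {E : Type*} [NormedAddCommGroup E] [NormedSpace ℝ E]
    {F : E → E} {ρ M c : ℝ} (hρ : 0 ≤ ρ) (hM : 0 < M) (hc : c * ρ ≤ M)
    (hF : Differentiable ℝ F)
    (hlip : ∀ x y : E, ‖fderiv ℝ F x - fderiv ℝ F y‖ ≤ ρ * ‖x - y‖) {w x y : E} (hne : y ≠ x)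
    (hstep : F x + fderiv ℝ F w (y - x) + (M * ‖y - x‖) • (y - x) = 0) :
    c * ‖x - (M * ‖y - x‖)⁻¹ • F y - y‖ ≤ ‖y - x‖ + ‖x - w‖ := by
  have hr : 0 < ‖y - x‖ := norm_pos_iff.2 (sub_ne_zero.2 hne)
  have hγ : 0 < M * ‖y - x‖ := mul_pos hM hr
  have hmodel : y - x = -((M * ‖y - x‖)⁻¹ • (F x + fderiv ℝ F w (y - x))) := by
    rw [eq_neg_of_add_eq_zero_left hstep, smul_neg, neg_neg, inv_smul_smul₀ hγ.ne']
  have heq : x - (M * ‖y - x‖)⁻¹ • F y - y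
      = -((M * ‖y - x‖)⁻¹ • (F y - F x - fderiv ℝ F w (y - x))) := by
    have : x - (M * ‖y - x‖)⁻¹ • F y - y = -(M * ‖y - x‖)⁻¹ • F y - (y - x) := by
      rw [neg_smul]; abel
    rw [this, sub_eq_add_neg, neg_eq_iff_eq_neg.2 hmodel, sub_sub, smul_sub, neg_smul]
    abel
  have hbound := norm_sub_sub_fderiv_apply_le hρ hF hlip w x y
  rw [heq, norm_neg, norm_smul, norm_inv, Real.norm_of_nonneg hγ.le]
  rcases le_total c 0 with hc0 | hc0
  · exact (mul_nonpos_of_nonpos_of_nonneg hc0 (by positivity)).trans (by positivity)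
  rw [mul_left_comm, inv_mul_le_iff₀ hγ]
  calc c * ‖F y - F x - fderiv ℝ F w (y - x)‖
      ≤ c * (ρ * (‖y - x‖ + ‖x - w‖) * ‖y - x‖) := mul_le_mul_of_nonneg_left hbound hc0
    _ = c * ρ * ((‖y - x‖ + ‖x - w‖) * ‖y - x‖) := by ring
    _ ≤ M * ((‖y - x‖ + ‖x - w‖) * ‖y - x‖) := by gcongr
    _ = M * ‖y - x‖ * (‖y - x‖ + ‖x - w‖) := by ring

/-- If errors `d i` are controlled by the step lengths `r i` and the accumulated drift `D i`, then
over a window of length at most `m` the errors are square-summably dominated by the steps. -/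
theorem sum_sq_error_le {r d D : ℕ → ℝ} {m N : ℕ} (hm : 1 ≤ m) (hN : N ≤ m)
    (hd : ∀ i < N, 0 ≤ d i) (hD : ∀ i < N, 0 ≤ D i)
    (hdrift : ∀ i < N, D i ≤ ∑ j ∈ Finset.range i, (r j + d j))
    (herr : ∀ i < N, 3 * (m : ℝ) * d i ≤ r i + D i) :
    7 * ∑ i ∈ Finset.range N, d i ^ 2 ≤ 4 * ∑ i ∈ Finset.range N, r i ^ 2 := by
  have hm0 : (0 : ℝ) < (m : ℝ) ^ 2 := by positivity
  set R := ∑ i ∈ Finset.range N, r i ^ 2 with hR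
  set Δ := ∑ i ∈ Finset.range N, d i ^ 2 with hΔ
  have hR0 : 0 ≤ R := Finset.sum_nonneg fun i _ => sq_nonneg _
  have hΔ0 : 0 ≤ Δ := Finset.sum_nonneg fun i _ => sq_nonneg _
  have hDsq : ∀ i ∈ Finset.range N, D i ^ 2 ≤ (i : ℝ) * (2 * (R + Δ)) := by
    intro i hi
    have hi' := Finset.mem_range.1 hi
    calc D i ^ 2 ≤ (∑ j ∈ Finset.range i, (r j + d j)) ^ 2 :=
          pow_le_pow_left₀ (hD i hi') (hdrift i hi') 2
      _ ≤ (i : ℝ) * ∑ j ∈ Finset.range i, (r j + d j) ^ 2 := by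
          simpa using sq_sum_le_card_mul_sum_sq (s := Finset.range i) (f := fun j => r j + d j)
      _ ≤ (i : ℝ) * ∑ j ∈ Finset.range N, (r j + d j) ^ 2 := by
          gcongr
      _ ≤ (i : ℝ) * (2 * (R + Δ)) := by
          gcongr
          rw [hR, hΔ, ← Finset.sum_add_distrib, Finset.mul_sum]
          exact Finset.sum_le_sum fun j _ => by nlinarith [sq_nonneg (r j - d j)]
  have hgauss : (∑ i ∈ Finset.range N, (i : ℝ)) * 2 ≤ (m : ℝ) ^ 2 := by
    have h1 := Finset.sum_range_id_mul_two N
    have h2 : N * (N - 1) ≤ m ^ 2 := by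
      rw [sq]; exact Nat.mul_le_mul hN (by omega)
    rw [← h1] at h2
    rw [← Nat.cast_sum]
    exact_mod_cast h2
  have hDsum : ∑ i ∈ Finset.range N, D i ^ 2 ≤ (m : ℝ) ^ 2 * (R + Δ) := by
    refine (Finset.sum_le_sum hDsq).trans ?_
    rw [← Finset.sum_mul]
    nlinarith
  have hsum : 9 * (m : ℝ) ^ 2 * Δ ≤ 2 * R + 2 * ∑ i ∈ Finset.range N, D i ^ 2 := by
    rw [hR, hΔ, Finset.mul_sum, Finset.mul_sum, Finset.mul_sum, ← Finset.sum_add_distrib]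
    refine Finset.sum_le_sum fun i hi => ?_
    have hi' := Finset.mem_range.1 hi
    have := pow_le_pow_left₀ (mul_nonneg (by positivity) (hd i hi')) (herr i hi') 2
    nlinarith [sq_nonneg (r i - D i)]
  have hmR : R ≤ (m : ℝ) ^ 2 * R :=
    le_mul_of_one_le_left hR0 (one_le_pow₀ (by exact_mod_cast hm))
  refine le_of_mul_le_mul_left (?_ : (m : ℝ) ^ 2 * _ ≤ _ * _) hm0
  linarith

/-- Boundedness of LEN iterates: for a differentiable monotone `F` with
`ρ`-Lipschitz derivative and a zero `z*` of `F`, any LEN trajectory with snapshot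
period `m ≥ 1` and `M ≥ 3ρm` satisfies `‖z_t − z*‖ ≤ ‖z_0 − z*‖` for `t ≤ T`, and
`‖z_t − h_t‖ ≤ 2‖z_0 − z*‖` and `‖h_t − z*‖ ≤ 3‖z_0 − z*‖` for `t < T`. -/
theorem len_iterates_bounded {E : Type*} [NormedAddCommGroup E]
    [InnerProductSpace ℝ E] [FiniteDimensional ℝ E]
    (F : E → E) (ρ M : ℝ) (m T : ℕ) (hm : 1 ≤ m) (hM : 0 < M)
    (hMρ : 3 * ρ * (m : ℝ) ≤ M) (hT : 1 ≤ T)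
    (hF : Differentiable ℝ F)
    (hmono : ∀ z z' : E, 0 ≤ ⟪F z - F z', z - z'⟫)
    (hlip : ∀ z z' : E, ‖fderiv ℝ F z - fderiv ℝ F z'‖ ≤ ρ * ‖z - z'‖)
    (zstar : E) (hzstar : F zstar = 0)
    (z h : ℕ → E)
    (hne : ∀ t < T, h t ≠ z t)
    (hstep : ∀ t < T,
      F (z t) + (fderiv ℝ F (z (m * (t / m)))) (h t - z t) +
        (M * ‖h t - z t‖) • (h t - z t) = 0)
    (hupd : ∀ t < T, z (t + 1) = z t - (M * ‖h t - z t‖)⁻¹ • F (h t)) :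
    (∀ t ≤ T, ‖z t - zstar‖ ≤ ‖z 0 - zstar‖) ∧
      (∀ t < T, ‖z t - h t‖ ≤ 2 * ‖z 0 - zstar‖ ∧ ‖h t - zstar‖ ≤ 3 * ‖z 0 - zstar‖) := by
  have hρ : 0 ≤ ρ := by
    have h0 : 0 < ‖h 0 - z 0‖ := norm_pos_iff.2 (sub_ne_zero.2 (hne 0 (by omega)))
    exact nonneg_of_mul_nonneg_left ((norm_nonneg _).trans (hlip (h 0) (z 0))) h0
  have epoch : ∀ k N : ℕ, N ≤ m → m * k + N ≤ T →
      7 * ‖z (m * k + N) - zstar‖ ^ 2 + 3 * ∑ i ∈ Finset.range N,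
        ‖h (m * k + i) - z (m * k + i)‖ ^ 2 ≤ 7 * ‖z (m * k) - zstar‖ ^ 2 := by
    intro k N hN hT'
    have hdiv : ∀ i < N, m * ((m * k + i) / m) = m * k := by
      intro i hi
      rw [Nat.mul_add_div (by omega), Nat.div_eq_of_lt (by omega), add_zero]
    have hbound := sum_sq_error_le (N := N)
      (r := fun i => ‖h (m * k + i) - z (m * k + i)‖)
      (d := fun i => ‖z (m * k + (i + 1)) - h (m * k + i)‖)
      (D := fun i => ‖z (m * k + i) - z (m * k)‖) hm hN
      (fun _ _ => norm_nonneg _) (fun _ _ => norm_nonneg _)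
      (fun i _ => by
        have hsum := norm_sum_le (Finset.range i)
          (fun j => z (m * k + (j + 1)) - z (m * k + j))
        rw [Finset.sum_range_sub (fun j => z (m * k + j))] at hsum
        refine hsum.trans (Finset.sum_le_sum fun j _ => ?_)
        rw [add_comm ‖h (m * k + j) - _‖]
        exact norm_sub_le_norm_sub_add_norm_sub _ _ _)
      (fun i hi => by
        have hi' : m * k + i < T := by omega
        have hs := hstep _ hi'
        rw [hdiv i hi] at hs
        have := norm_len_step_sub_le hρ hM (c := 3 * m) (by linarith) hF hlip (hne _ hi') hs
        rwa [← hupd _ hi'] at this)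
    have htel : ∑ i ∈ Finset.range N, ‖h (m * k + i) - z (m * k + i)‖ ^ 2
        ≤ ∑ i ∈ Finset.range N, ‖z (m * k + (i + 1)) - h (m * k + i)‖ ^ 2
          - (‖z (m * k + N) - zstar‖ ^ 2 - ‖z (m * k) - zstar‖ ^ 2) := by
      have := Finset.sum_range_sub (fun i => ‖z (m * k + i) - zstar‖ ^ 2) N
      simp only [add_zero] at this
      rw [← this, ← Finset.sum_sub_distrib]
      refine Finset.sum_le_sum fun i hi => ?_
      have hi' : m * k + i < T := by have := Finset.mem_range.1 hi; omega
      have hv := hmono (h (m * k + i)) zstar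
      rw [hzstar, sub_zero] at hv
      have := extragradient_step (x := z (m * k + i))
        (inv_nonneg.2 (mul_nonneg hM.le (norm_nonneg (h (m * k + i) - z (m * k + i))))) hv
      rw [← hupd _ hi', add_assoc] at this
      linarith
    linarith
  have hstart : ∀ k : ℕ, m * k ≤ T → ‖z (m * k) - zstar‖ ^ 2 ≤ ‖z 0 - zstar‖ ^ 2 := by
    intro k
    induction k with
    | zero => simp
    | succ k ih =>
      intro hk
      rw [Nat.mul_succ] at hk ⊢
      have h1 := epoch k m le_rfl hk
      have h2 : 0 ≤ ∑ i ∈ Finset.range m, ‖h (m * k + i) - z (m * k + i)‖ ^ 2 :=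
        Finset.sum_nonneg fun i _ => sq_nonneg _
      linarith [ih (by omega)]
  have hdist : ∀ t ≤ T, ‖z t - zstar‖ ≤ ‖z 0 - zstar‖ := by
    intro t ht
    have hdecomp := Nat.div_add_mod t m
    have h1 := epoch (t / m) (t % m) (Nat.mod_lt t hm).le (by omega)
    have h2 : 0 ≤ ∑ i ∈ Finset.range (t % m),
        ‖h (m * (t / m) + i) - z (m * (t / m) + i)‖ ^ 2 :=
      Finset.sum_nonneg fun i _ => sq_nonneg _
    have h3 := hstart (t / m) (by omega)
    rw [hdecomp] at h1
    exact le_of_sq_le_sq (by linarith) (norm_nonneg _)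
  refine ⟨hdist, fun t ht => ?_⟩
  have hhalf : ‖z t - h t‖ ≤ 2 * ‖z 0 - zstar‖ := by
    have hdecomp := Nat.div_add_mod t m
    have hlt := Nat.mod_lt t hm
    have h1 := epoch (t / m) (t % m + 1) hlt (by omega)
    have h2 := Finset.single_le_sum
      (f := fun i => ‖h (m * (t / m) + i) - z (m * (t / m) + i)‖ ^ 2)
      (fun i _ => sq_nonneg _) (Finset.self_mem_range_succ (t % m))
    have h3 := hstart (t / m) (by omega)
    simp only [hdecomp] at h2
    rw [norm_sub_rev]
    refine le_of_sq_le_sq ?_ (by positivity)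
    nlinarith [sq_nonneg ‖z (m * (t / m) + (t % m + 1)) - zstar‖, sq_nonneg ‖z 0 - zstar‖]
  refine ⟨hhalf, ?_⟩
  have := norm_sub_le_norm_sub_add_norm_sub (h t) (z t) zstar
  rw [norm_sub_rev (h t) (z t)] at this
  linarith [hdist t ht.le]
end

section
/- Let F : E → E be differentiable and μ-strongly monotone for some μ > 0, with ρ-Lipschitz derivative, and suppose z* ∈ E satisfies F(z*) = 0. Let m ≥ 1, let M > 0 with M ≥ 3ρm, let T ≥ 1, and let (z_t)_{t ≤ T}, (h_t)_{t < T} be a LEN trajectory for F with snapshot period m started at z_0. Define z̄_T := (∑_{t=0}^{T−1} γ_t^{−1} h_t)/(∑_{t=0}^{T−1} γ_t^{−1}). Then ‖z̄_T − z*‖² ≤ M·‖z_0 − z*‖³ / (μ·T^{3/2}). -/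
open RealInnerProductSpace

/-- A sequence dominated by sliding-window averages over windows of length at most `m` is
controlled in `ℓ²`. -/
theorem sum_sq_le_of_mul_le_sum_Icc {m : ℕ} (hm : 0 < m) (T : ℕ) (c : ℝ) {a e : ℕ → ℝ}
    (he : ∀ t < T, 0 ≤ e t) (hc : 0 ≤ c)
    (h : ∀ t < T, c * m * e t ≤ ∑ s ∈ Finset.Icc (m * (t / m)) t, a s) :
    c ^ 2 * ∑ t ∈ Finset.range T, e t ^ 2 ≤ ∑ t ∈ Finset.range T, a t ^ 2 := by
  have hm' : (0 : ℝ) < m := by exact_mod_cast hm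
  have hwin : ∀ t < T, c ^ 2 * m * e t ^ 2 ≤ ∑ s ∈ Finset.Icc (m * (t / m)) t, a s ^ 2 := by
    intro t ht
    have h0 : 0 ≤ c * m * e t := mul_nonneg (mul_nonneg hc hm'.le) (he t ht)
    have h1 := pow_le_pow_left₀ h0 (h t ht) 2
    have h2 := sq_sum_le_card_mul_sum_sq (s := Finset.Icc (m * (t / m)) t) (f := a)
    have hcard : ((Finset.Icc (m * (t / m)) t).card : ℝ) ≤ m := by
      rw [Nat.card_Icc]
      have := Nat.div_add_mod t m
      have := Nat.mod_lt t hm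
      exact_mod_cast (by omega : t + 1 - m * (t / m) ≤ m)
    have h3 := mul_le_mul_of_nonneg_right hcard
      (Finset.sum_nonneg fun s (_ : s ∈ Finset.Icc (m * (t / m)) t) => sq_nonneg (a s))
    refine le_of_mul_le_mul_left ?_ hm'
    calc (m : ℝ) * (c ^ 2 * m * e t ^ 2) = (c * m * e t) ^ 2 := by ring
      _ ≤ _ := h1.trans (h2.trans h3)
  have hswap : ∑ t ∈ Finset.range T, ∑ s ∈ Finset.Icc (m * (t / m)) t, a s ^ 2 =
      ∑ s ∈ Finset.range T,
        ∑ _t ∈ (Finset.range T).filter (fun t => m * (t / m) ≤ s ∧ s ≤ t), a s ^ 2 := by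
    refine Finset.sum_comm' fun t s => ?_
    simp only [Finset.mem_range, Finset.mem_Icc, Finset.mem_filter]
    constructor
    · rintro ⟨h1, h2, h3⟩
      exact ⟨⟨h1, h2, h3⟩, by omega⟩
    · rintro ⟨⟨h1, h2, h3⟩, -⟩
      exact ⟨h1, h2, h3⟩
  refine le_of_mul_le_mul_left ?_ hm'
  calc (m : ℝ) * (c ^ 2 * ∑ t ∈ Finset.range T, e t ^ 2)
      = ∑ t ∈ Finset.range T, c ^ 2 * m * e t ^ 2 := by
        rw [← Finset.mul_sum]; ring
    _ ≤ ∑ t ∈ Finset.range T, ∑ s ∈ Finset.Icc (m * (t / m)) t, a s ^ 2 :=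
        Finset.sum_le_sum fun t ht => hwin t (Finset.mem_range.1 ht)
    _ ≤ (m : ℝ) * ∑ t ∈ Finset.range T, a t ^ 2 := by
        rw [hswap, Finset.mul_sum]
        refine Finset.sum_le_sum fun s _ => ?_
        rw [Finset.sum_const, nsmul_eq_mul]
        refine mul_le_mul_of_nonneg_right ?_ (sq_nonneg _)
        have hsub : (Finset.range T).filter (fun t => m * (t / m) ≤ s ∧ s ≤ t) ⊆
            Finset.Ico s (s + m) := by
          intro t ht
          simp only [Finset.mem_filter, Finset.mem_Ico] at ht ⊢
          have := Nat.div_add_mod t m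
          have := Nat.mod_lt t hm
          omega
        have := Finset.card_le_card hsub
        rw [Nat.card_Ico] at this
        exact_mod_cast (by omega)

/-- First-order Taylor bound with the derivative frozen at a third point. -/
theorem norm_sub_sub_fderiv_le {E G : Type*} [NormedAddCommGroup E] [NormedSpace ℝ E]
    [NormedAddCommGroup G] [NormedSpace ℝ G] {F : E → G} {ρ : ℝ} (hρ : 0 ≤ ρ)
    (hF : Differentiable ℝ F)
    (hlip : ∀ z z' : E, ‖fderiv ℝ F z - fderiv ℝ F z'‖ ≤ ρ * ‖z - z'‖) (w x y : E) :
    ‖F y - F x - fderiv ℝ F w (y - x)‖ ≤ ρ * (‖y - x‖ + ‖x - w‖) * ‖y - x‖ := by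
  refine (convex_closedBall x ‖y - x‖).norm_image_sub_le_of_norm_fderiv_le'
    (fun v _ => hF v) (fun v hv => ?_) (by simp) (by simp [dist_eq_norm])
  refine (hlip v w).trans (mul_le_mul_of_nonneg_left ?_ hρ)
  rw [mem_closedBall_iff_norm] at hv
  linarith [norm_sub_le_norm_sub_add_norm_sub v x w]

/-- Jensen's inequality for the squared distance to a point from a weighted average. -/
theorem sum_mul_norm_sq_center_le {ι E : Type*} [NormedAddCommGroup E] [NormedSpace ℝ E]
    (s : Finset ι) {w : ι → ℝ} (hw : ∀ i ∈ s, 0 ≤ w i) (hW : 0 < ∑ i ∈ s, w i)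
    (x : ι → E) (p : E) :
    (∑ i ∈ s, w i) * ‖(∑ i ∈ s, w i)⁻¹ • ∑ i ∈ s, w i • x i - p‖ ^ 2 ≤
      ∑ i ∈ s, w i * ‖x i - p‖ ^ 2 := by
  set W := ∑ i ∈ s, w i with hWdef
  have hcenter : W • (W⁻¹ • ∑ i ∈ s, w i • x i - p) = ∑ i ∈ s, w i • (x i - p) := by
    simp only [smul_sub, Finset.sum_sub_distrib]
    rw [smul_inv_smul₀ hW.ne', ← Finset.sum_smul]
  have hnorm : W * ‖W⁻¹ • ∑ i ∈ s, w i • x i - p‖ ≤ ∑ i ∈ s, w i * ‖x i - p‖ := by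
    calc _ = ‖W • (W⁻¹ • ∑ i ∈ s, w i • x i - p)‖ := by
          rw [norm_smul, Real.norm_of_nonneg hW.le]
      _ ≤ _ := by
          rw [hcenter]
          refine norm_sum_le_of_le _ fun i hi => ?_
          rw [norm_smul, Real.norm_of_nonneg (hw i hi)]
  have hcs : (∑ i ∈ s, w i * ‖x i - p‖) ^ 2 ≤ W * ∑ i ∈ s, w i * ‖x i - p‖ ^ 2 :=
    Finset.sum_sq_le_sum_mul_sum_of_sq_le_mul s hw
      (fun i hi => mul_nonneg (hw i hi) (sq_nonneg _)) (fun i _ => le_of_eq (by ring))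
  refine le_of_mul_le_mul_left ?_ hW
  calc _ = (W * ‖W⁻¹ • ∑ i ∈ s, w i • x i - p‖) ^ 2 := by ring
    _ ≤ _ := (pow_le_pow_left₀ (by positivity) hnorm 2).trans hcs

/-- Power-mean inequality between the exponents `-1` and `2`. -/
theorem card_pow_three_le_sq_sum_inv_mul_sum_sq {ι : Type*} (s : Finset ι) {r : ι → ℝ}
    (hr : ∀ i ∈ s, 0 < r i) :
    (s.card : ℝ) ^ 3 ≤ (∑ i ∈ s, (r i)⁻¹) ^ 2 * ∑ i ∈ s, r i ^ 2 := by
  rcases s.eq_empty_or_nonempty with rfl | hs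
  · simp
  have hcard : (0 : ℝ) < s.card := by exact_mod_cast hs.card_pos
  have h1 : (∑ _i ∈ s, (1 : ℝ)) ^ 2 ≤ (∑ i ∈ s, (r i)⁻¹) * ∑ i ∈ s, r i :=
    Finset.sum_sq_le_sum_mul_sum_of_sq_le_mul s (fun i hi => (inv_pos.2 (hr i hi)).le)
      (fun i hi => (hr i hi).le)
      (fun i hi => by rw [one_pow, inv_mul_cancel₀ (hr i hi).ne'])
  rw [Finset.sum_const, nsmul_eq_mul, mul_one] at h1
  have h2 := sq_sum_le_card_mul_sum_sq (s := s) (f := r)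
  refine le_of_mul_le_mul_left ?_ hcard
  calc (s.card : ℝ) * s.card ^ 3 = ((s.card : ℝ) ^ 2) ^ 2 := by ring
    _ ≤ ((∑ i ∈ s, (r i)⁻¹) * ∑ i ∈ s, r i) ^ 2 := pow_le_pow_left₀ (by positivity) h1 2
    _ = (∑ i ∈ s, (r i)⁻¹) ^ 2 * (∑ i ∈ s, r i) ^ 2 := by ring
    _ ≤ (∑ i ∈ s, (r i)⁻¹) ^ 2 * (s.card * ∑ i ∈ s, r i ^ 2) :=
        mul_le_mul_of_nonneg_left h2 (sq_nonneg _)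
    _ = _ := by ring

/-- Four-point identity for the inner product of two differences. -/
theorem two_mul_inner_sub_sub {E : Type*} [NormedAddCommGroup E] [InnerProductSpace ℝ E]
    (a b x p : E) :
    2 * ⟪a - b, x - p⟫ = ‖a - p‖ ^ 2 - ‖b - p‖ ^ 2 + ‖b - x‖ ^ 2 - ‖x - a‖ ^ 2 := by
  simp only [norm_sub_sq_real, inner_sub_left, inner_sub_right, real_inner_comm a x]
  ring

/-- One-epoch contraction of LEN under strong monotonicity: for a differentiable
`μ`-strongly monotone `F` (`μ > 0`) with `ρ`-Lipschitz derivative and zero `z*`,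
any LEN trajectory with snapshot period `m ≥ 1` and `M ≥ 3ρm` satisfies
`‖z̄_T − z*‖² ≤ M‖z_0 − z*‖³/(μ T^{3/2})`, where
`z̄_T = (∑ γ_t⁻¹ h_t)/(∑ γ_t⁻¹)` and `γ_t = M‖h_t − z_t‖`. -/
theorem len_strongly_monotone_contraction {E : Type*} [NormedAddCommGroup E]
    [InnerProductSpace ℝ E] [FiniteDimensional ℝ E]
    (F : E → E) (μ ρ M : ℝ) (hμ : 0 < μ) (m T : ℕ) (hm : 1 ≤ m) (hM : 0 < M)
    (hMρ : 3 * ρ * (m : ℝ) ≤ M) (hT : 1 ≤ T)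
    (hF : Differentiable ℝ F)
    (hmono : ∀ z z' : E, μ * ‖z - z'‖ ^ 2 ≤ ⟪F z - F z', z - z'⟫)
    (hlip : ∀ z z' : E, ‖fderiv ℝ F z - fderiv ℝ F z'‖ ≤ ρ * ‖z - z'‖)
    (zstar : E) (hzstar : F zstar = 0)
    (z h : ℕ → E)
    (hne : ∀ t < T, h t ≠ z t)
    (hstep : ∀ t < T,
      F (z t) + (fderiv ℝ F (z (m * (t / m)))) (h t - z t) +
        (M * ‖h t - z t‖) • (h t - z t) = 0)
    (hupd : ∀ t < T, z (t + 1) = z t - (M * ‖h t - z t‖)⁻¹ • F (h t))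
    (zbar : E)
    (hzbar : zbar = (∑ t ∈ Finset.range T, (M * ‖h t - z t‖)⁻¹)⁻¹ •
      ∑ t ∈ Finset.range T, (M * ‖h t - z t‖)⁻¹ • h t) :
    ‖zbar - zstar‖ ^ 2 ≤ M * ‖z 0 - zstar‖ ^ 3 / (μ * (T : ℝ) ^ ((3 : ℝ) / 2)) := by
  have hr : ∀ t < T, 0 < ‖h t - z t‖ := fun t ht => norm_pos_iff.2 (sub_ne_zero.2 (hne t ht))
  have hm' : (0 : ℝ) < m := by exact_mod_cast hm
  have hρ : 0 ≤ ρ :=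
    nonneg_of_mul_nonneg_left ((norm_nonneg _).trans (hlip (h 0) (z 0))) (hr 0 hT)
  have hext : ∀ t < T, 3 * m * ‖z (t + 1) - h t‖ ≤
      ‖h t - z t‖ + ‖z t - z (m * (t / m))‖ := by
    intro t ht
    have hγ : 0 < M * ‖h t - z t‖ := mul_pos hM (hr t ht)
    have htaylor := norm_sub_sub_fderiv_le hρ hF hlip (z (m * (t / m))) (z t) (h t)
    have hres : (M * ‖h t - z t‖) • (z (t + 1) - h t) =
        -(F (h t) - F (z t) - fderiv ℝ F (z (m * (t / m))) (h t - z t)) := by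
      have hs := eq_neg_of_add_eq_zero_right (hstep t ht)
      rw [hupd t ht, smul_sub, smul_sub, smul_inv_smul₀ hγ.ne']
      rw [smul_sub, sub_eq_iff_eq_add] at hs
      rw [hs]
      abel
    have hnorm : M * ‖h t - z t‖ * ‖z (t + 1) - h t‖ ≤
        ρ * (‖h t - z t‖ + ‖z t - z (m * (t / m))‖) * ‖h t - z t‖ := by
      rw [← norm_neg, ← hres, norm_smul, Real.norm_of_nonneg hγ.le] at htaylor
      exact htaylor
    have hM' : M * ‖z (t + 1) - h t‖ ≤ ρ * (‖h t - z t‖ + ‖z t - z (m * (t / m))‖) :=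
      le_of_mul_le_mul_right (by linarith) (hr t ht)
    refine le_of_mul_le_mul_left ?_ hM
    calc M * (3 * m * ‖z (t + 1) - h t‖) = 3 * m * (M * ‖z (t + 1) - h t‖) := by ring
      _ ≤ 3 * m * (ρ * (‖h t - z t‖ + ‖z t - z (m * (t / m))‖)) := by gcongr
      _ = 3 * ρ * m * (‖h t - z t‖ + ‖z t - z (m * (t / m))‖) := by ring
      _ ≤ _ := by gcongr
  have hwin : ∀ t < T, 3 * m * ‖z (t + 1) - h t‖ ≤
      ∑ s ∈ Finset.Icc (m * (t / m)) t, (‖h s - z s‖ + ‖z (s + 1) - h s‖) := by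
    intro t ht
    have hle : m * (t / m) ≤ t := Nat.mul_div_le t m
    have hdrift : ‖z t - z (m * (t / m))‖ ≤
        ∑ s ∈ Finset.Ico (m * (t / m)) t, (‖h s - z s‖ + ‖z (s + 1) - h s‖) := by
      rw [← dist_eq_norm, dist_comm]
      refine dist_le_Ico_sum_of_dist_le hle fun {s} _ _ => ?_
      rw [dist_comm, dist_eq_norm]
      exact (norm_sub_le_norm_sub_add_norm_sub _ (h s) _).trans_eq (add_comm _ _)
    rw [← Finset.Ico_add_one_right_eq_Icc, Finset.sum_Ico_succ_top hle]
    linarith [hext t ht, norm_nonneg (z (t + 1) - h t)]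
  set S := ∑ t ∈ Finset.range T, ‖h t - z t‖ ^ 2 with hS
  set W := ∑ t ∈ Finset.range T, (M * ‖h t - z t‖)⁻¹ with hW
  set V := ∑ t ∈ Finset.range T, (M * ‖h t - z t‖)⁻¹ * ‖h t - zstar‖ ^ 2 with hV
  set D := ‖z 0 - zstar‖ with hD
  have herr : ∑ t ∈ Finset.range T, ‖z (t + 1) - h t‖ ^ 2 ≤ 2 / 7 * S := by
    have h1 := sum_sq_le_of_mul_le_sum_Icc hm T 3 (fun t _ => norm_nonneg (z (t + 1) - h t))
      (by norm_num) hwin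
    have h2 : ∑ t ∈ Finset.range T, (‖h t - z t‖ + ‖z (t + 1) - h t‖) ^ 2 ≤
        2 * S + 2 * ∑ t ∈ Finset.range T, ‖z (t + 1) - h t‖ ^ 2 := by
      rw [hS, Finset.mul_sum, Finset.mul_sum, ← Finset.sum_add_distrib]
      exact Finset.sum_le_sum fun t _ => by
        linarith [add_sq_le (a := ‖h t - z t‖) (b := ‖z (t + 1) - h t‖)]
    linarith
  have hdescent : 2 * μ * V ≤ D ^ 2 + ∑ t ∈ Finset.range T, ‖z (t + 1) - h t‖ ^ 2 - S := by
    have hterm : ∀ t ∈ Finset.range T,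
        2 * μ * ((M * ‖h t - z t‖)⁻¹ * ‖h t - zstar‖ ^ 2) ≤
          (‖z t - zstar‖ ^ 2 - ‖z (t + 1) - zstar‖ ^ 2) + ‖z (t + 1) - h t‖ ^ 2 -
            ‖h t - z t‖ ^ 2 := by
      intro t ht
      have ht := Finset.mem_range.1 ht
      have hγ : 0 < (M * ‖h t - z t‖)⁻¹ := inv_pos.2 (mul_pos hM (hr t ht))
      have hsm := hmono (h t) zstar
      rw [hzstar, sub_zero] at hsm
      have hid := two_mul_inner_sub_sub (z t) (z (t + 1)) (h t) zstar
      rw [hupd t ht, sub_sub_cancel, real_inner_smul_left, ← hupd t ht] at hid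
      linarith [mul_le_mul_of_nonneg_left hsm hγ.le]
    have hsum := Finset.sum_le_sum hterm
    rw [← Finset.mul_sum, Finset.sum_sub_distrib, Finset.sum_add_distrib,
      Finset.sum_range_sub' (fun t => ‖z t - zstar‖ ^ 2)] at hsum
    linarith [sq_nonneg ‖z T - zstar‖]
  have hWpos : 0 < W := Finset.sum_pos
    (fun t ht => inv_pos.2 (mul_pos hM (hr t (Finset.mem_range.1 ht))))
    (Finset.nonempty_range_iff.2 (by omega))
  have hjensen : W * ‖zbar - zstar‖ ^ 2 ≤ V := by
    rw [hzbar]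
    exact sum_mul_norm_sq_center_le (Finset.range T)
      (fun t _ => by positivity) hWpos h zstar
  have hV0 : 0 ≤ V := Finset.sum_nonneg fun t _ => by positivity
  have hS0 : 0 ≤ S := Finset.sum_nonneg fun t _ => by positivity
  have hμV := mul_nonneg hμ.le hV0
  have hpow : (T : ℝ) ^ 3 ≤ (M * W) ^ 2 * S := by
    have hpm := card_pow_three_le_sq_sum_inv_mul_sum_sq (Finset.range T)
      (fun t ht => hr t (Finset.mem_range.1 ht))
    have hMW : M * W = ∑ t ∈ Finset.range T, ‖h t - z t‖⁻¹ := by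
      rw [hW, Finset.mul_sum]
      exact Finset.sum_congr rfl fun t _ => by rw [mul_inv, mul_inv_cancel_left₀ hM.ne']
    rwa [Finset.card_range, ← hMW] at hpm
  have hT0 : (0 : ℝ) < T := by exact_mod_cast hT
  have hD0 : 0 ≤ D := norm_nonneg _
  have hrate : (T : ℝ) ^ ((3 : ℝ) / 2) ≤ 2 * (M * W) * D := by
    refine (sq_le_sq₀ (by positivity) (by positivity)).1 ?_
    rw [← Real.rpow_mul_natCast hT0.le, show (3 : ℝ) / 2 * (2 : ℕ) = (3 : ℕ) by norm_num,
      Real.rpow_natCast]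
    calc (T : ℝ) ^ 3 ≤ (M * W) ^ 2 * S := hpow
      _ ≤ (M * W) ^ 2 * (4 * D ^ 2) := by
          gcongr
          linarith [sq_nonneg D]
      _ = _ := by ring
  rw [le_div_iff₀ (by positivity)]
  calc ‖zbar - zstar‖ ^ 2 * (μ * (T : ℝ) ^ ((3 : ℝ) / 2))
      ≤ ‖zbar - zstar‖ ^ 2 * (μ * (2 * (M * W) * D)) := by gcongr
    _ = M * D * (2 * μ * (W * ‖zbar - zstar‖ ^ 2)) := by ring
    _ ≤ M * D * (2 * μ * V) := by gcongr
    _ ≤ M * D * D ^ 2 := by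
        gcongr
        linarith
    _ = M * D ^ 3 := by ring
end

section
/- Let A be a real d × d matrix whose symmetric part is positive semidefinite, i.e. xᵀAx ≥ 0 for every x ∈ ℝ^d, let b ∈ ℝ^d, and let M > 0. Then (i) for every γ > 0 the matrix A + γI is invertible, and (ii) the function φ(γ) := M·‖(A + γI)^{−1} b‖ − γ is strictly decreasing on (0, ∞): for all 0 < γ₁ < γ₂ one has φ(γ₂) < φ(γ₁). -/
open Matrix

namespace Matrix

variable {n : Type*} [Fintype n] {A : Matrix n n ℝ}

/-- A real matrix with positive semidefinite symmetric part becomes invertible after adding a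
positive multiple of the identity. -/
theorem isUnit_add_smul_one_of_dotProduct_mulVec_nonneg [DecidableEq n]
    (hA : ∀ x : n → ℝ, 0 ≤ x ⬝ᵥ (A *ᵥ x)) {γ : ℝ} (hγ : 0 < γ) :
    IsUnit (A + γ • (1 : Matrix n n ℝ)) := by
  rw [← mulVec_injective_iff_isUnit, ← coe_mulVecLin, injective_iff_map_eq_zero]
  intro x hx
  have h : x ⬝ᵥ (A *ᵥ x) + γ * (x ⬝ᵥ x) = 0 := by
    have := congrArg (x ⬝ᵥ ·) hx
    simpa [add_mulVec, smul_mulVec] using this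
  have hx₀ : 0 ≤ x ⬝ᵥ x := Finset.sum_nonneg fun i _ => mul_self_nonneg (x i)
  exact dotProduct_self_eq_zero.mp (by nlinarith [hA x])

/-- The squared norm of the solution `x` of `A x + γ x = b` is antitone in `γ > 0` when the
symmetric part of `A` is positive semidefinite. -/
theorem dotProduct_self_le_of_mulVec_add_smul_eq
    (hA : ∀ x : n → ℝ, 0 ≤ x ⬝ᵥ (A *ᵥ x)) {γ₁ γ₂ : ℝ} (hγ₁ : 0 < γ₁) (hγ : γ₁ < γ₂)
    {x y : n → ℝ} (h : A *ᵥ x + γ₁ • x = A *ᵥ y + γ₂ • y) : y ⬝ᵥ y ≤ x ⬝ᵥ x := by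
  obtain ⟨z, rfl⟩ : ∃ z, x = y + z := ⟨x - y, by simp⟩
  have hz : A *ᵥ z = (γ₂ - γ₁) • y - γ₁ • z := by
    rw [mulVec_add] at h
    linear_combination h - smul_add γ₁ y z - sub_smul γ₂ γ₁ y
  have hAz := hA z
  rw [hz, dotProduct_sub, dotProduct_smul, dotProduct_smul, smul_eq_mul, smul_eq_mul] at hAz
  have hzz : 0 ≤ z ⬝ᵥ z := Finset.sum_nonneg fun i _ => mul_self_nonneg (z i)
  have hzy : 0 ≤ z ⬝ᵥ y := by
    refine nonneg_of_mul_nonneg_right (a := γ₂ - γ₁) ?_ (sub_pos.mpr hγ)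
    nlinarith
  rw [add_dotProduct, dotProduct_add, dotProduct_add, dotProduct_comm y z]
  linarith

end Matrix

/-- For a real `d × d` matrix `A` with positive semidefinite symmetric part
(`xᵀAx ≥ 0` for all `x`), `b ∈ ℝ^d` and `M > 0`: (i) `A + γI` is invertible for
every `γ > 0`, and (ii) `φ(γ) = M‖(A + γI)⁻¹ b‖ − γ` (Euclidean norm) is strictly
decreasing on `(0, ∞)`. -/
theorem regularized_resolvent_invertible_and_phi_strictAnti {d : ℕ}
    (A : Matrix (Fin d) (Fin d) ℝ)
    (hA : ∀ x : Fin d → ℝ, 0 ≤ x ⬝ᵥ (A *ᵥ x))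
    (b : Fin d → ℝ) (M : ℝ) (hM : 0 < M) :
    (∀ γ : ℝ, 0 < γ → IsUnit (A + γ • (1 : Matrix (Fin d) (Fin d) ℝ))) ∧
      (∀ γ₁ γ₂ : ℝ, 0 < γ₁ → γ₁ < γ₂ →
        M * Real.sqrt (∑ i, ((A + γ₂ • (1 : Matrix (Fin d) (Fin d) ℝ))⁻¹ *ᵥ b) i ^ 2) - γ₂ <
          M * Real.sqrt (∑ i, ((A + γ₁ • (1 : Matrix (Fin d) (Fin d) ℝ))⁻¹ *ᵥ b) i ^ 2) - γ₁) := by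
  have hunit (γ : ℝ) (hγ : 0 < γ) : IsUnit (A + γ • (1 : Matrix (Fin d) (Fin d) ℝ)) :=
    isUnit_add_smul_one_of_dotProduct_mulVec_nonneg hA hγ
  refine ⟨hunit, fun γ₁ γ₂ hγ₁ hγ => ?_⟩
  have hsol (γ : ℝ) (hγ : 0 < γ) :
      A *ᵥ ((A + γ • (1 : Matrix (Fin d) (Fin d) ℝ))⁻¹ *ᵥ b) +
        γ • ((A + γ • (1 : Matrix (Fin d) (Fin d) ℝ))⁻¹ *ᵥ b) = b := by
    have hdet := (isUnit_iff_isUnit_det _).mp (hunit γ hγ)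
    have h : (A + γ • (1 : Matrix (Fin d) (Fin d) ℝ)) *ᵥ
        ((A + γ • (1 : Matrix (Fin d) (Fin d) ℝ))⁻¹ *ᵥ b) = b := by
      rw [mulVec_mulVec, mul_nonsing_inv _ hdet, one_mulVec]
    rwa [add_mulVec, smul_mulVec, one_mulVec] at h
  have hle := dotProduct_self_le_of_mulVec_add_smul_eq hA hγ₁ hγ
    ((hsol γ₁ hγ₁).trans (hsol γ₂ (hγ₁.trans hγ)).symm)
  simp only [dotProduct, ← pow_two] at hle
  linarith [mul_le_mul_of_nonneg_left (Real.sqrt_le_sqrt hle) hM.le]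
end

section
/- Let E be a real inner product space, let A : E → E be monotone, and let z ∈ E. Suppose 0 < η' ≤ η and u', u ∈ E satisfy the resolvent equations u' + η'·A(u') = z and u + η·A(u) = z. Then (η/η')·η'·‖u' − z‖ ≤ η·‖u − z‖ ≤ (η/η')²·η'·‖u' − z‖; that is, with φ(η) := η·‖u − z‖ and φ(η') := η'·‖u' − z‖ one has (η/η')·φ(η') ≤ φ(η) ≤ (η/η')²·φ(η'). -/
open RealInnerProductSpace

/-- Comparison of resolvent displacements for a monotone operator: if `A` is
monotone, `0 < η' ≤ η`, `u' + η'·A(u') = z` and `u + η·A(u) = z`, then with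
`φ(η) = η‖u − z‖` and `φ(η') = η'‖u' − z‖` one has
`(η/η')·φ(η') ≤ φ(η) ≤ (η/η')²·φ(η')`. -/
theorem resolvent_displacement_comparison {E : Type*} [NormedAddCommGroup E]
    [InnerProductSpace ℝ E]
    (A : E → E) (hmono : ∀ u v : E, 0 ≤ ⟪A u - A v, u - v⟫)
    (z : E) (η' η : ℝ) (hη' : 0 < η') (hle : η' ≤ η)
    (u' u : E) (hres' : u' + η' • A u' = z) (hres : u + η • A u = z) :
    η / η' * (η' * ‖u' - z‖) ≤ η * ‖u - z‖ ∧
      η * ‖u - z‖ ≤ (η / η') ^ 2 * (η' * ‖u' - z‖) := by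
  have hη : 0 < η := hη'.trans_le hle
  have hu : u - z = -(η • A u) := by rw [← hres]; abel
  have hu' : u' - z = -(η' • A u') := by rw [← hres']; abel
  have hsub : u - u' = η' • A u' - η • A u := by
    rw [← sub_sub_sub_cancel_right u u' z, hu, hu']; abel
  have hnorm : ‖u - z‖ = η * ‖A u‖ := by
    rw [hu, norm_neg, norm_smul, Real.norm_of_nonneg hη.le]
  have hnorm' : ‖u' - z‖ = η' * ‖A u'‖ := by
    rw [hu', norm_neg, norm_smul, Real.norm_of_nonneg hη'.le]
  have hprod : (‖A u'‖ - ‖A u‖) * (η' * ‖A u'‖ - η * ‖A u‖) ≤ 0 := by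
    have h := hmono u u'
    rw [hsub] at h
    simp only [inner_sub_left, inner_sub_right, real_inner_smul_right,
      real_inner_self_eq_norm_sq, real_inner_comm (A u) (A u')] at h
    have hcs := mul_le_mul_of_nonneg_left (real_inner_le_norm (A u) (A u'))
      (add_pos hη hη').le
    linarith [real_inner_comm (A u) (A u')]
  have hupper : ‖A u‖ ≤ ‖A u'‖ := by
    by_contra! hlt
    have h₁ : η' * ‖A u'‖ < η' * ‖A u‖ := mul_lt_mul_of_pos_left hlt hη'
    have h₂ : η' * ‖A u‖ ≤ η * ‖A u‖ := mul_le_mul_of_nonneg_right hle (norm_nonneg _)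
    nlinarith
  have hlower : η' * ‖A u'‖ ≤ η * ‖A u‖ := by
    by_contra! hlt
    have h₁ : ‖A u'‖ ≤ ‖A u‖ := by
      by_contra! hlt'
      nlinarith
    have h₂ : η' * ‖A u'‖ ≤ η * ‖A u‖ := mul_le_mul hle h₁ (norm_nonneg _) hη.le
    exact absurd hlt h₂.not_gt
  rw [hnorm, hnorm']
  constructor
  · calc η / η' * (η' * (η' * ‖A u'‖)) = η * (η' * ‖A u'‖) := by field_simp
      _ ≤ η * (η * ‖A u‖) := mul_le_mul_of_nonneg_left hlower hη.le
  · calc η * (η * ‖A u‖) ≤ η * (η * ‖A u'‖) := by gcongr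
      _ = (η / η') ^ 2 * (η' * (η' * ‖A u'‖)) := by field_simp
end
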